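/- arXiv:2110.03459 — 5 statements merged into one kernel-verified Lean document; each statement's English description precedes it below -/
import Mathlib

section
/- The lagged random walk satisfies a detailed-balance identity with respect to the unnormalized pair weights: for all nodes i, h, j ∈ U, q_{(i,h)} · P_{(i,h)}(j) = q_{(j,h)} · P_{(j,h)}(i). -/
/-- The lagged random walk satisfies a detailed-balance identity with respect
to the unnormalized pair weights: for all nodes `i, h, j ∈ U`,
`q (i,h) * P (i,h) j = q (j,h) * P (j,h) i`. -/
theorem lrw_detailed_balance
    {U : Type*} [Fintype U] [DecidableEq U] [Nonempty U]
    (a : U → U → ℝ)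
    (ha : ∀ i j, a i j = 0 ∨ a i j = 1)
    (hsym : ∀ i j, a i j = a j i)
    (hdiag : ∀ i, a i i = 0)
    (N : ℝ) (hN : N = (Fintype.card U : ℝ))
    (d : U → ℝ) (hd : ∀ i, d i = ∑ j, a i j)
    (r : ℝ) (hr : 0 < r)
    (w : ℝ) (hw0 : 0 ≤ w) (hw1 : w ≤ 1)
    (P : U → U → U → ℝ)
    (hP : ∀ i h j, P i h j =
      if d h ≤ 1 then
        r / ((d h + r) * N) + a h j / (d h + r)
      else
        r / ((d h + r) * N)
          + (if j = i then w * a h j / (d h + r) else 0)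
          + (if j ≠ i then ((d h - w * a i h) / (d h + r)) * (a h j / (d h - a i h)) else 0))
    (q : U → U → ℝ)
    (hq : ∀ i h, q i h = if a i h = 1 then 1 + r / N else r / N) :
    ∀ i h j : U, q i h * P i h j = q j h * P j h i := by
  intro i h j
  have hi : a h i = a i h := hsym h i
  have hj : a h j = a j h := hsym h j
  rcases eq_or_ne j i with rfl | hne
  · rfl
  rw [hP, hP, hq, hq, hi, hj]
  by_cases hdh : d h ≤ 1
  · rcases ha i h with h1 | h1 <;> rcases ha j h with h2 | h2 <;>
      simp only [hdh, h1, h2, div_mul_eq_div_div, if_true, zero_ne_one, if_false] <;> ring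
  · have hd0 : d h ≠ 0 := by linarith
    rcases ha i h with h1 | h1 <;> rcases ha j h with h2 | h2 <;>
      simp [hdh, h1, h2, hne, hne.symm] <;> field_simp <;> ring
end

section
/- (Paper's Lemma, pair-chain part) The distribution π_{(i,h)} = q_{(i,h)}/(2R + rN) is stationary for the Markov chain of consecutive pairs of the lagged random walk: for every (h,j) ∈ U×U, Σ_{i∈U} π_{(i,h)} · P_{(i,h)}(j) = π_{(h,j)}. This holds for every backtracking parameter w ∈ [0,1]. -/
/-- Paper's Lemma, pair-chain part: The distribution
`π (i,h) = q (i,h) / (2R + rN)` is stationary for the Markov chain of consecutive pairs of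
the lagged random walk: for every `(h,j) ∈ U × U`,
`∑ i, π (i,h) * P (i,h) j = π (h,j)`, for every backtracking parameter `w ∈ [0,1]`. -/
theorem lrw_pair_stationary
    {U : Type*} [Fintype U] [DecidableEq U] [Nonempty U]
    (a : U → U → ℝ)
    (ha : ∀ i j, a i j = 0 ∨ a i j = 1)
    (hsym : ∀ i j, a i j = a j i)
    (hdiag : ∀ i, a i i = 0)
    (N : ℝ) (hN : N = (Fintype.card U : ℝ))
    (d : U → ℝ) (hd : ∀ i, d i = ∑ j, a i j)
    (R : ℝ) (hR : ∑ i, d i = 2 * R)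
    (r : ℝ) (hr : 0 < r)
    (w : ℝ) (hw0 : 0 ≤ w) (hw1 : w ≤ 1)
    (P : U → U → U → ℝ)
    (hP : ∀ i h j, P i h j =
      if d h ≤ 1 then
        r / ((d h + r) * N) + a h j / (d h + r)
      else
        r / ((d h + r) * N)
          + (if j = i then w * a h j / (d h + r) else 0)
          + (if j ≠ i then ((d h - w * a i h) / (d h + r)) * (a h j / (d h - a i h)) else 0))
    (q : U → U → ℝ)
    (hq : ∀ i h, q i h = if a i h = 1 then 1 + r / N else r / N)
    (π : U → U → ℝ)
    (hπ : ∀ i h, π i h = q i h / (2 * R + r * N)) :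
    ∀ h j : U, ∑ i, π i h * P i h j = π h j := by
  intro h j
  have hNpos : 0 < N := by
    rw [hN]
    exact_mod_cast Fintype.card_pos
  obtain ⟨c, hc⟩ : ∃ c, c = r / N := ⟨_, rfl⟩
  have hcN : N * c = r := by
    rw [hc]
    field_simp
  have hq' : ∀ i k, q i k = a i k + c := by
    intro i k
    rw [hq, hc]
    rcases ha i k with h0 | h1
    · simp [h0]
    · simp [h1]
  have hsum : ∑ i, a i h = d h := by
    rw [hd]
    exact Finset.sum_congr rfl fun i _ => hsym i h
  have hd0 : 0 ≤ d h := by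
    rw [hd]
    exact Finset.sum_nonneg fun i _ => by rcases ha h i with hi | hi <;> simp [hi]
  have hdr : d h + r ≠ 0 := by positivity
  have hrc : r / ((d h + r) * N) = c / (d h + r) := by
    rw [hc, div_div, mul_comm]
  have hsumAffine : ∀ x y : ℝ, ∑ i, (x + a i h * y) = N * x + d h * y := by
    intro x y
    rw [Finset.sum_add_distrib, ← Finset.sum_mul, hsum, hN]
    simp
  have hsumq : ∑ i, q i h = d h + r := by
    calc ∑ i, q i h = ∑ i, (c + a i h * 1) :=
          Finset.sum_congr rfl fun i _ => by rw [hq']; ring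
      _ = d h + r := by rw [hsumAffine, hcN]; ring
  have key : ∑ i, q i h * P i h j = q h j := by
    by_cases hle : d h ≤ 1
    · simp only [hP, if_pos hle]
      rw [← Finset.sum_mul, hsumq, hrc, hq']
      field_simp
      ring
    · have hd1 : d h - 1 ≠ 0 := by linarith
      have hdh : d h ≠ 0 := by linarith
      rcases ha h j with h0 | h1
      · have hPj : ∀ i, P i h j = c / (d h + r) := by
          intro i
          rw [hP, if_neg hle, hrc]
          simp [h0]
        simp only [hPj]
        rw [← Finset.sum_mul, hsumq, hq', h0]
        field_simp
        ring
      · obtain ⟨K, hK⟩ : ∃ K, K = (1 + c) * (d h - w) / (d h - 1) - c := ⟨_, rfl⟩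
        have hterm : ∀ i, q i h * P i h j =
            q i h * (c / (d h + r)) + ((c / (d h + r) + a i h * (K / (d h + r))) +
              if i = j then ((1 + c) * w - (c + K)) / (d h + r) else 0) := by
          intro i
          rw [hP, if_neg hle, hrc, hq']
          by_cases hij : i = j
          · subst hij
            have : a i h = 1 := by rw [hsym, h1]
            simp [h1, this]
            field_simp
            ring
          · have hji : j ≠ i := fun e => hij e.symm
            rcases ha i h with hi | hi
            · simp [hi, hij, hji, h1]
              field_simp
            · simp [hi, hij, hji, h1, hK]
              field_simp
              ring
        simp only [hterm]
        rw [Finset.sum_add_distrib, Finset.sum_add_distrib, ← Finset.sum_mul, hsumq,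
          hsumAffine, Finset.sum_ite_eq' Finset.univ j, if_pos (Finset.mem_univ j), hq', h1]
        have hN' : N * (c / (d h + r)) = r / (d h + r) := by rw [← mul_div_assoc, hcN]
        rw [hN', hK]
        field_simp
        ring
  rw [hπ, ← key, Finset.sum_div]
  exact Finset.sum_congr rfl fun i _ => by rw [hπ]; ring
end

section
/- (Expected number of collisions) Let X_1, ..., X_{n_x} and Y_1, ..., Y_{n_y} be U-valued random variables such that the family (X_1,...,X_{n_x}) is independent of the family (Y_1,...,Y_{n_y}) and each individual X_i and each Y_j has marginal distribution π_h = (d_h + r)/(2R + rN). Then the weighted collision count m = Σ_{i=1}^{n_x} Σ_{j=1}^{n_y} 1{X_i = Y_j}/(d_{Y_j} + r) satisfies E(m) = n_x·n_y/(2R + rN). -/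
/-- Law of the unconscious statistician on a finite space with mass function `p`. -/
theorem sum_mass_mul_comp {Ω A : Type*} [Fintype Ω] [Fintype A] [DecidableEq A]
    (p : Ω → ℝ) (V : Ω → A) (F : A → ℝ) :
    ∑ ω, p ω * F (V ω) = ∑ v, F v * ∑ ω, if V ω = v then p ω else 0 := by
  simp_rw [Finset.mul_sum]
  rw [Finset.sum_comm]
  refine Finset.sum_congr rfl fun ω _ => ?_
  simp [mul_comm]

/-- On a finite space with mass function `p`, the expectation of a product of functions of two
independent random variables factors. -/
theorem sum_mass_mul_mul_of_indep {Ω A B : Type*} [Fintype Ω] [Fintype A] [Fintype B]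
    [DecidableEq A] [DecidableEq B] (p : Ω → ℝ) (V : Ω → A) (W : Ω → B)
    (h : ∀ v w, (∑ ω, if V ω = v ∧ W ω = w then p ω else 0)
      = (∑ ω, if V ω = v then p ω else 0) * (∑ ω, if W ω = w then p ω else 0))
    (f : A → ℝ) (g : B → ℝ) :
    ∑ ω, p ω * (f (V ω) * g (W ω)) = (∑ ω, p ω * f (V ω)) * ∑ ω, p ω * g (W ω) := by
  rw [sum_mass_mul_comp p V f, sum_mass_mul_comp p W g,
    sum_mass_mul_comp p (fun ω => (V ω, W ω)) (fun q => f q.1 * g q.2),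
    Fintype.sum_prod_type, Finset.sum_mul_sum]
  refine Finset.sum_congr rfl fun v _ => Finset.sum_congr rfl fun w _ => ?_
  simp only [Prod.mk.injEq]
  rw [h]
  ring


/-- Expected number of collisions: if the family `(X 1, ..., X nx)` is
independent of the family `(Y 1, ..., Y ny)` and each `X i`, `Y j` has marginal
distribution `π h = (d h + r)/(2R + rN)`, then the weighted collision count
`m = ∑ i ∑ j 1{X i = Y j}/(d (Y j) + r)` satisfies `E m = nx * ny / (2R + rN)`.
Here the underlying probability space is a finite space `Ω'` with mass function `p`. -/
theorem lrw_expected_collisions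
    {U : Type*} [Fintype U] [DecidableEq U] [Nonempty U]
    (a : U → U → ℝ)
    (ha : ∀ i j, a i j = 0 ∨ a i j = 1)
    (hsym : ∀ i j, a i j = a j i)
    (hdiag : ∀ i, a i i = 0)
    (N : ℝ) (hN : N = (Fintype.card U : ℝ))
    (d : U → ℝ) (hd : ∀ i, d i = ∑ j, a i j)
    (R : ℝ) (hR : ∑ i, d i = 2 * R)
    (r : ℝ) (hr : 0 < r)
    {Ω' : Type*} [Fintype Ω']
    (p : Ω' → ℝ) (hp : ∀ ω, 0 ≤ p ω) (hp1 : ∑ ω, p ω = 1)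
    (nx ny : ℕ) (hnx : 1 ≤ nx) (hny : 1 ≤ ny)
    (X : Fin nx → Ω' → U) (Y : Fin ny → Ω' → U)
    (hX : ∀ (i : Fin nx) (h : U),
      (∑ ω, if X i ω = h then p ω else 0) = (d h + r) / (2 * R + r * N))
    (hY : ∀ (j : Fin ny) (h : U),
      (∑ ω, if Y j ω = h then p ω else 0) = (d h + r) / (2 * R + r * N))
    (hindep : ∀ (x : Fin nx → U) (y : Fin ny → U),
      (∑ ω, if (∀ i, X i ω = x i) ∧ (∀ j, Y j ω = y j) then p ω else 0)
        = (∑ ω, if ∀ i, X i ω = x i then p ω else 0)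
          * (∑ ω, if ∀ j, Y j ω = y j then p ω else 0)) :
    (∑ ω, p ω * ∑ i : Fin nx, ∑ j : Fin ny,
        if X i ω = Y j ω then 1 / (d (Y j ω) + r) else 0)
      = (nx : ℝ) * (ny : ℝ) / (2 * R + r * N) := by
  have hd0 : ∀ h, 0 ≤ d h := fun h => by
    rw [hd]
    exact Finset.sum_nonneg fun j _ => by rcases ha h j with e | e <;> simp [e]
  have hdr : ∀ h, 0 < d h + r := fun h => by linarith [hd0 h]
  have hsum : ∑ h, (d h + r) = 2 * R + r * N := by
    rw [Finset.sum_add_distrib, hR, hN]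
    simp [mul_comm]
  have hT : 0 < 2 * R + r * N :=
    hsum ▸ Finset.sum_pos (fun h _ => hdr h) Finset.univ_nonempty
  have hfactor := sum_mass_mul_mul_of_indep p (fun ω i => X i ω) (fun ω j => Y j ω)
    (by simpa only [funext_iff] using hindep)
  have hpair : ∀ i j, (∑ ω, p ω * if X i ω = Y j ω then 1 / (d (Y j ω) + r) else 0)
      = 1 / (2 * R + r * N) := fun i j => by
    calc (∑ ω, p ω * if X i ω = Y j ω then 1 / (d (Y j ω) + r) else 0)
        = ∑ h, (∑ ω, p ω * ((if X i ω = h then 1 else 0) *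
            (if Y j ω = h then 1 else 0))) / (d h + r) := by
          simp_rw [Finset.sum_div]
          rw [Finset.sum_comm]
          refine Finset.sum_congr rfl fun ω _ => ?_
          rw [Finset.sum_eq_single (Y j ω)]
          · by_cases e : X i ω = Y j ω <;> simp [e, div_eq_mul_inv]
          · intro h _ hne
            simp [hne.symm]
          · simp
      _ = ∑ h, (d h + r) / (2 * R + r * N) ^ 2 := by
          refine Finset.sum_congr rfl fun h _ => ?_
          have e := hfactor (fun x => if x i = h then 1 else 0) (fun y => if y j = h then 1 else 0)
          simp only [mul_ite, mul_one, mul_zero, hX, hY] at e ⊢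
          rw [e]
          have := (hdr h).ne'
          field_simp
      _ = 1 / (2 * R + r * N) := by
          rw [← Finset.sum_div, hsum]
          field_simp
  simp_rw [Finset.mul_sum]
  rw [Finset.sum_comm]
  simp_rw [Finset.sum_comm (s := (Finset.univ : Finset Ω')), hpair]
  simp [mul_assoc, div_eq_mul_inv]
end

section
/- (Capture–recapture identity) Under the hypotheses that (X_1,...,X_{n_x}) is independent of (Y_1,...,Y_{n_y}) and each variable has marginal π_h = (d_h + r)/(2R + rN), the expectation E(m) of the weighted collision count m = Σ_{i}Σ_{j} 1{X_i = Y_j}/(d_{Y_j} + r) satisfies (n_x·n_y/E(m) − rN)/2 = R; i.e., the capture–recapture estimator R̂_1 = (n_x n_y/m − rN)/2 recovers the graph size exactly when m is replaced by its expectation. -/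
/-- A weighted sum of a function of `f` is the sum over the values of `f`, weighted by the
mass of the fibres. -/
theorem sum_mul_comp_eq_sum_fiber {Ω α : Type*} [Fintype Ω] [Fintype α] [DecidableEq α]
    (p : Ω → ℝ) (f : Ω → α) (u : α → ℝ) :
    ∑ ω, p ω * u (f ω) = ∑ a, u a * ∑ ω, if f ω = a then p ω else 0 := by
  simp_rw [Finset.mul_sum]
  rw [Finset.sum_comm]
  refine Finset.sum_congr rfl fun ω _ => ?_
  simp [mul_comm]

/-- If the joint masses of `f` and `g` factor, so do the expectations of products. -/
theorem sum_mul_comp_mul_comp_of_indep {Ω α β : Type*} [Fintype Ω] [Fintype α] [Fintype β]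
    [DecidableEq α] [DecidableEq β] (p : Ω → ℝ) (f : Ω → α) (g : Ω → β)
    (h : ∀ a b, (∑ ω, if f ω = a ∧ g ω = b then p ω else 0)
      = (∑ ω, if f ω = a then p ω else 0) * ∑ ω, if g ω = b then p ω else 0)
    (u : α → ℝ) (v : β → ℝ) :
    ∑ ω, p ω * (u (f ω) * v (g ω)) = (∑ ω, p ω * u (f ω)) * ∑ ω, p ω * v (g ω) := by
  have key := sum_mul_comp_eq_sum_fiber p (fun ω => (f ω, g ω)) (fun c => u c.1 * v c.2)
  simp only [Prod.mk.injEq, Fintype.sum_prod_type, h] at key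
  rw [key, sum_mul_comp_eq_sum_fiber p f u, sum_mul_comp_eq_sum_fiber p g v,
    Finset.sum_mul_sum]
  exact Finset.sum_congr rfl fun a _ => Finset.sum_congr rfl fun b _ => by ring

/-- Capture–recapture identity: under the hypotheses that
`(X 1, ..., X nx)` is independent of `(Y 1, ..., Y ny)` and each variable has marginal
`π h = (d h + r)/(2R + rN)`, the expectation `E m` of the weighted collision count
`m = ∑ i ∑ j 1{X i = Y j}/(d (Y j) + r)` satisfies `(nx * ny / E m − r N)/2 = R`;
i.e. the capture–recapture estimator `R̂₁ = (nx ny / m − rN)/2` recovers the graph size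
exactly when `m` is replaced by its expectation. -/
theorem lrw_capture_recapture
    {U : Type*} [Fintype U] [DecidableEq U] [Nonempty U]
    (a : U → U → ℝ)
    (ha : ∀ i j, a i j = 0 ∨ a i j = 1)
    (hsym : ∀ i j, a i j = a j i)
    (hdiag : ∀ i, a i i = 0)
    (N : ℝ) (hN : N = (Fintype.card U : ℝ))
    (d : U → ℝ) (hd : ∀ i, d i = ∑ j, a i j)
    (R : ℝ) (hR : ∑ i, d i = 2 * R)
    (r : ℝ) (hr : 0 < r)
    {Ω' : Type*} [Fintype Ω']
    (p : Ω' → ℝ) (hp : ∀ ω, 0 ≤ p ω) (hp1 : ∑ ω, p ω = 1)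
    (nx ny : ℕ) (hnx : 1 ≤ nx) (hny : 1 ≤ ny)
    (X : Fin nx → Ω' → U) (Y : Fin ny → Ω' → U)
    (hX : ∀ (i : Fin nx) (h : U),
      (∑ ω, if X i ω = h then p ω else 0) = (d h + r) / (2 * R + r * N))
    (hY : ∀ (j : Fin ny) (h : U),
      (∑ ω, if Y j ω = h then p ω else 0) = (d h + r) / (2 * R + r * N))
    (hindep : ∀ (x : Fin nx → U) (y : Fin ny → U),
      (∑ ω, if (∀ i, X i ω = x i) ∧ (∀ j, Y j ω = y j) then p ω else 0)
        = (∑ ω, if ∀ i, X i ω = x i then p ω else 0)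
          * (∑ ω, if ∀ j, Y j ω = y j then p ω else 0))
    (Em : ℝ)
    (hEm : Em = ∑ ω, p ω * ∑ i : Fin nx, ∑ j : Fin ny,
        if X i ω = Y j ω then 1 / (d (Y j ω) + r) else 0) :
    ((nx : ℝ) * (ny : ℝ) / Em - r * N) / 2 = R := by
  have hd0 : ∀ i, 0 ≤ d i := fun i => by
    rw [hd]
    exact Finset.sum_nonneg fun j _ => by rcases ha i j with h | h <;> simp [h]
  have hpos : ∀ h, 0 < d h + r := fun h => by linarith [hd0 h]
  have hS : ∑ h, (d h + r) = 2 * R + r * N := by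
    rw [Finset.sum_add_distrib, hR, hN]
    simp [mul_comm]
  have hD : 0 < 2 * R + r * N := by
    rw [← hS]
    exact Finset.sum_pos (fun h _ => hpos h) Finset.univ_nonempty
  have hjoint : ∀ i j h, (∑ ω, p ω * ((if X i ω = h then 1 else 0) *
      (if Y j ω = h then 1 else 0))) = ((d h + r) / (2 * R + r * N)) ^ 2 := by
    intro i j h
    have key := sum_mul_comp_mul_comp_of_indep p (fun ω i => X i ω) (fun ω j => Y j ω)
      (fun x y => by simpa only [funext_iff] using hindep x y)
      (fun x => if x i = h then 1 else 0) (fun y => if y j = h then 1 else 0)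
    rw [key]
    simp only [mul_ite, mul_one, mul_zero, hX, hY, sq]
  have hpair : ∀ i j, (∑ ω, p ω * if X i ω = Y j ω then 1 / (d (Y j ω) + r) else 0)
      = 1 / (2 * R + r * N) := by
    intro i j
    calc _ = ∑ ω, ∑ h, 1 / (d h + r) * (p ω * ((if X i ω = h then 1 else 0) *
          (if Y j ω = h then 1 else 0))) := by
          refine Finset.sum_congr rfl fun ω _ => ?_
          simp [mul_comm]
      _ = ∑ h, (d h + r) / (2 * R + r * N) ^ 2 := by
          rw [Finset.sum_comm]
          refine Finset.sum_congr rfl fun h _ => ?_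
          rw [← Finset.mul_sum, hjoint]
          have := (hpos h).ne'
          field_simp
      _ = _ := by
          rw [← Finset.sum_div, hS]
          field_simp
  have hE : Em = (nx : ℝ) * ny / (2 * R + r * N) := by
    simp_rw [hEm, Finset.mul_sum]
    rw [Finset.sum_comm]
    simp_rw [Finset.sum_comm (s := (Finset.univ : Finset Ω')), hpair]
    simp
    ring
  have hx : (nx : ℝ) ≠ 0 := by positivity
  have hy : (ny : ℝ) ≠ 0 := by positivity
  rw [hE, div_div_cancel₀ (mul_ne_zero hx hy)]
  ring
end

section
/- (Generalised ratio identities) If X is a U-valued random variable with distribution π_h = (d_h + r)/(2R + rN), then E[d_X/(d_X + r)] = 2R/(2R + rN) and E[1/(d_X + r)] = N/(2R + rN); consequently E[d_X/(d_X + r)] / E[1/(d_X + r)] = 2R/N, so the generalised ratio of weighted degree averages identifies the average degree 2R/N exactly in expectation. -/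
/-- Generalised ratio identities: if `X` is a `U`-valued random variable
with distribution `π h = (d h + r)/(2R + rN)`, then `E[d X/(d X + r)] = 2R/(2R + rN)` and
`E[1/(d X + r)] = N/(2R + rN)`; consequently
`E[d X/(d X + r)] / E[1/(d X + r)] = 2R/N`, so the generalised ratio of weighted degree
averages identifies the average degree `2R/N` exactly in expectation. -/
theorem lrw_generalised_ratio
    {U : Type*} [Fintype U] [DecidableEq U] [Nonempty U]
    (a : U → U → ℝ)
    (ha : ∀ i j, a i j = 0 ∨ a i j = 1)
    (hsym : ∀ i j, a i j = a j i)
    (hdiag : ∀ i, a i i = 0)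
    (N : ℝ) (hN : N = (Fintype.card U : ℝ))
    (d : U → ℝ) (hd : ∀ i, d i = ∑ j, a i j)
    (R : ℝ) (hR : ∑ i, d i = 2 * R)
    (r : ℝ) (hr : 0 < r)
    (π : U → ℝ)
    (hπ : ∀ h, π h = (d h + r) / (2 * R + r * N)) :
    (∑ h, π h * (d h / (d h + r)) = 2 * R / (2 * R + r * N))
      ∧ (∑ h, π h * (1 / (d h + r)) = N / (2 * R + r * N))
      ∧ (∑ h, π h * (d h / (d h + r))) / (∑ h, π h * (1 / (d h + r))) = 2 * R / N := by
  have hd0 : ∀ i, 0 ≤ d i := fun i => by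
    rw [hd i]
    exact Finset.sum_nonneg fun j _ => by rcases ha i j with h | h <;> simp [h]
  have hN0 : 0 < N := by
    rw [hN]
    exact_mod_cast Fintype.card_pos
  have hR0 : 0 ≤ 2 * R := hR ▸ Finset.sum_nonneg fun i _ => hd0 i
  have hT : 2 * R + r * N ≠ 0 := (add_pos_of_nonneg_of_pos hR0 (mul_pos hr hN0)).ne'
  have hdr : ∀ h, d h + r ≠ 0 := fun h => (add_pos_of_nonneg_of_pos (hd0 h) hr).ne'
  have weighted_sum : ∀ f : U → ℝ,
      ∑ h, π h * (f h / (d h + r)) = (∑ h, f h) / (2 * R + r * N) := fun f => by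
    rw [Finset.sum_div]
    refine Finset.sum_congr rfl fun h _ => ?_
    rw [hπ h, div_mul_div_comm, mul_comm (2 * R + r * N), mul_div_mul_left _ _ (hdr h)]
  have degree_mean : ∑ h, π h * (d h / (d h + r)) = 2 * R / (2 * R + r * N) := by
    rw [weighted_sum, hR]
  have inverse_mean : ∑ h, π h * (1 / (d h + r)) = N / (2 * R + r * N) := by
    rw [weighted_sum fun _ => 1, hN]
    simp
  refine ⟨degree_mean, inverse_mean, ?_⟩
  rw [degree_mean, inverse_mean, div_div_div_cancel_right₀ hT]
end
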